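/- arXiv:2003.05175 — 2 statements merged into one kernel-verified Lean document; each statement's English description precedes it below -/
import Mathlib

section
/- Let G be a finite simple graph, let M be a matching in G, let k be a positive even integer, and let u be a vertex of G that is exposed with respect to M. Suppose that every augmenting path in G with respect to M that does not contain u has length at least k + 1. Let P be an augmenting path in G with respect to M that contains u and has minimum length among all augmenting paths with respect to M that contain u. Then every augmenting path in G with respect to M△P has length at least k + 1. -/
open scoped Classical symmDiff

/-- `M` is a matching in the simple graph `G`: a set of edges of `G`
no two of which share an endpoint. -/
def IsMatching {V : Type*} (G : SimpleGraph V) (M : Finset (Sym2 V)) : Prop :=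
  (M : Set (Sym2 V)) ⊆ G.edgeSet ∧
    ∀ e ∈ M, ∀ f ∈ M, e ≠ f → ∀ v : V, v ∈ e → v ∉ f

/-- A vertex is matched by `M` if it is an endpoint of some edge of `M`. -/
def Matched {V : Type*} (M : Finset (Sym2 V)) (v : V) : Prop :=
  ∃ e ∈ M, v ∈ e

/-- A list of edges alternates with respect to the matching `M`. -/
def Alternating {V : Type*} (M : Finset (Sym2 V)) (l : List (Sym2 V)) : Prop :=
  ∀ (i : ℕ) (h : i + 1 < l.length), ((l[i]'(by omega)) ∈ M ↔ (l[i + 1]'h) ∉ M)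

/-- `p` is an augmenting path in `G` with respect to the matching `M`:
a path with at least one edge, both of whose endpoints are exposed, and whose
edges alternate between edges not in `M` and edges in `M`. -/
structure IsAugPath {V : Type*} (G : SimpleGraph V) (M : Finset (Sym2 V))
    {a b : V} (p : G.Walk a b) : Prop where
  isPath : p.IsPath
  pos : 0 < p.length
  expA : ¬ Matched M a
  expB : ¬ Matched M b
  alt : Alternating M p.edges


section

open SimpleGraph

theorem IsMatching.eq_of_mem {V : Type*} {G : SimpleGraph V} {M : Finset (Sym2 V)}
    (hM : IsMatching G M) {e f : Sym2 V} (he : e ∈ M) (hf : f ∈ M) {v : V}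
    (hve : v ∈ e) (hvf : v ∈ f) : e = f := by
  by_contra h
  exact hM.2 e he f hf h v hve hvf

theorem SimpleGraph.Walk.IsPath.eq_or_eq_of_getVert_mem {V : Type*} {G : SimpleGraph V} {a b : V}
    {p : G.Walk a b} (hp : p.IsPath) {i : ℕ} (hi : i ≤ p.length) {g : Sym2 V}
    (hg : g ∈ p.edges) (hv : p.getVert i ∈ g) :
    (0 < i ∧ g = s(p.getVert (i - 1), p.getVert i)) ∨
      (i < p.length ∧ g = s(p.getVert i, p.getVert (i + 1))) := by
  obtain ⟨j, hj, rfl⟩ := List.mem_iff_getElem.mp hg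
  rw [Walk.getElem_edges] at hv ⊢
  rw [Walk.length_edges] at hj
  rcases Sym2.mem_iff.mp hv with h | h
  · have : i = j := hp.getVert_injOn (by simpa using hi) (by simp; omega) h
    subst this
    exact Or.inr ⟨hj, rfl⟩
  · have : i = j + 1 := hp.getVert_injOn (by simpa using hi) (by simp; omega) h
    subst this
    exact Or.inl ⟨by omega, rfl⟩

theorem SimpleGraph.Walk.mk_getVert_mem_edges {V : Type*} {G : SimpleGraph V} {a b : V}
    (p : G.Walk a b) {i : ℕ} (hi : i < p.length) :
    s(p.getVert i, p.getVert (i + 1)) ∈ p.edges := by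
  have h : i < p.edges.length := by simpa using hi
  rw [← Walk.getElem_edges h]
  exact List.getElem_mem h

theorem IsAugPath.exists_edges_at {V : Type*} {G : SimpleGraph V} {M : Finset (Sym2 V)}
    (hM : IsMatching G M) {a b : V} {p : G.Walk a b} (hp : IsAugPath G M p) {v : V}
    (hv : v ∈ p.support) :
    (v = a ∨ v = b ∨ Matched M v) ∧ (∀ g ∈ M, v ∈ g → g ∈ p.edges) ∧
      ∃ e ∈ p.edges, e ∉ M ∧ v ∈ e ∧ ∀ g ∈ p.edges, v ∈ g → g ∉ M → g = e := by
  obtain ⟨i, rfl, hi⟩ := Walk.mem_support_iff_exists_getVert.mp hv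
  have hpos := hp.pos
  have key := fun g => hp.isPath.eq_or_eq_of_getVert_mem hi (g := g)
  rcases Nat.eq_zero_or_pos i with rfl | h0
  · have hmem := p.mk_getVert_mem_edges hpos
    have hexp := hp.expA
    rw [Walk.getVert_zero] at *
    refine ⟨Or.inl rfl, fun g hg hvg => absurd ⟨g, hg, hvg⟩ hexp, _, hmem,
      fun h => hexp ⟨_, h, by simp⟩, by simp, fun g hg hvg _ => ?_⟩
    simpa [hpos] using key g hg hvg
  obtain ⟨j, rfl⟩ : ∃ j, i = j + 1 := ⟨i - 1, by omega⟩
  have hmem := p.mk_getVert_mem_edges (show j < p.length by omega)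
  rcases hi.eq_or_lt with hl | hl
  · have hexp := hp.expB
    have hb : p.getVert (j + 1) = b := by rw [hl, Walk.getVert_length]
    rw [hb] at hmem key ⊢
    refine ⟨Or.inr (Or.inl rfl), fun g hg hvg => absurd ⟨g, hg, hvg⟩ hexp, _, hmem,
      fun h => hexp ⟨_, h, by simp⟩, by simp, fun g hg hvg _ => ?_⟩
    simpa [hl.not_lt] using key g hg hvg
  · have hmem' := p.mk_getVert_mem_edges hl
    have alt := hp.alt j (by simpa using hl)
    rw [Walk.getElem_edges, Walk.getElem_edges] at alt
    simp only [Nat.add_sub_cancel] at key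
    by_cases hin : s(p.getVert j, p.getVert (j + 1)) ∈ M
    · have hout := alt.mp hin
      refine ⟨Or.inr (Or.inr ⟨_, hin, by simp⟩), fun g hg hvg => ?_, _, hmem', hout, by simp,
        fun g hg hvg hgM => ?_⟩
      · rwa [hM.eq_of_mem hg hin hvg (by simp)]
      · rcases key g hg hvg with h | h
        · exact absurd (h.2 ▸ hin) hgM
        · exact h.2
    · have hin' := not_not.mp (mt alt.mpr hin)
      refine ⟨Or.inr (Or.inr ⟨_, hin', by simp⟩), fun g hg hvg => ?_, _, hmem, hin, by simp,
        fun g hg hvg hgM => ?_⟩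
      · rwa [hM.eq_of_mem hg hin' hvg (by simp)]
      · rcases key g hg hvg with h | h
        · exact h.2
        · exact absurd (h.2 ▸ hin') hgM

theorem IsAugPath.isMatching_symmDiff {V : Type*} [DecidableEq V] {G : SimpleGraph V}
    {M : Finset (Sym2 V)} (hM : IsMatching G M) {a b : V} {p : G.Walk a b}
    (hp : IsAugPath G M p) : IsMatching G (M ∆ p.edges.toFinset) := by
  refine ⟨fun e he => ?_, fun e he f hf hef v hve hvf => hef ?_⟩
  · rcases Finset.mem_symmDiff.mp he with h | h
    · exact hM.1 h.1
    · exact p.edges_subset_edgeSet (List.mem_toFinset.mp h.1)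
  · simp only [Finset.mem_symmDiff, List.mem_toFinset] at he hf
    by_cases hv : v ∈ p.support
    · obtain ⟨-, hMp, e₀, -, -, -, huniq⟩ := hp.exists_edges_at hM hv
      have eq_of : ∀ g, (g ∈ M ∧ g ∉ p.edges ∨ g ∈ p.edges ∧ g ∉ M) → v ∈ g → g = e₀ := by
        rintro g (⟨h₁, h₂⟩ | ⟨h₁, h₂⟩) hvg
        · exact absurd (hMp g h₁ hvg) h₂
        · exact huniq g h₁ hvg h₂
      rw [eq_of e he hve, eq_of f hf hvf]
    · have mem_of : ∀ g, (g ∈ M ∧ g ∉ p.edges ∨ g ∈ p.edges ∧ g ∉ M) → v ∈ g → g ∈ M := by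
        rintro g (⟨h₁, h₂⟩ | ⟨h₁, h₂⟩) hvg
        · exact h₁
        · exact absurd (Walk.mem_support_of_mem_edges h₁ hvg) hv
      exact hM.eq_of_mem (mem_of e he hve) (mem_of f hf hvf) hve hvf

theorem IsAugPath.matched_symmDiff_iff {V : Type*} [DecidableEq V] {G : SimpleGraph V}
    {M : Finset (Sym2 V)} (hM : IsMatching G M) {a b : V} {p : G.Walk a b}
    (hp : IsAugPath G M p) (v : V) :
    Matched (M ∆ p.edges.toFinset) v ↔ Matched M v ∨ v = a ∨ v = b := by
  by_cases hv : v ∈ p.support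
  · obtain ⟨h, -, e, he, heM, hve, -⟩ := hp.exists_edges_at hM hv
    refine iff_of_true ⟨e, ?_, hve⟩ (by tauto)
    exact Finset.mem_symmDiff.mpr (Or.inr ⟨List.mem_toFinset.mpr he, heM⟩)
  · have hva : v ≠ a := fun h => hv (h ▸ p.start_mem_support)
    have hvb : v ≠ b := fun h => hv (h ▸ p.end_mem_support)
    simp only [hva, hvb, or_false]
    refine exists_congr fun e => and_congr_left fun hve => ?_
    have : e ∉ p.edges := fun h => hv (Walk.mem_support_of_mem_edges h hve)
    simp [Finset.mem_symmDiff, this]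

theorem alternating_of_isPath {V : Type*} [DecidableEq V] {G H : SimpleGraph V}
    {M N : Finset (Sym2 V)} (hM : IsMatching G M) (hN : IsMatching G N)
    (hH : H.edgeSet ⊆ ((M ∆ N : Finset (Sym2 V)) : Set (Sym2 V))) {a b : V} {p : H.Walk a b} (hp : p.IsPath) :
    Alternating M p.edges := by
  intro i hi
  have hne : p.edges[i] ≠ p.edges[i + 1] := fun h => by
    have := (hp.isTrail.edges_nodup.getElem_inj_iff).mp h
    omega
  have h₀ := hH (p.edges_subset_edgeSet (List.getElem_mem (Nat.lt_of_succ_lt hi)))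
  have h₁ := hH (p.edges_subset_edgeSet (List.getElem_mem hi))
  have hv₀ : p.getVert (i + 1) ∈ p.edges[i] := by simp [Walk.getElem_edges]
  have hv₁ : p.getVert (i + 1) ∈ p.edges[i + 1] := by simp [Walk.getElem_edges]
  rw [Finset.mem_coe, Finset.mem_symmDiff] at h₀ h₁
  have hM' := fun h h' => hne (hM.eq_of_mem h h' hv₀ hv₁)
  have hN' := fun h h' => hne (hN.eq_of_mem h h' hv₀ hv₁)
  tauto

theorem SimpleGraph.exists_ne_reachable_odd_degree {V : Type*} [Fintype V] (H : SimpleGraph V)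
    [DecidableRel H.Adj] {x : V} (hx : Odd (H.degree x)) : ∃ y, y ≠ x ∧ H.Reachable x y ∧ Odd (H.degree y) := by
  let K : SimpleGraph V :=
    { Adj := fun v w => H.Reachable x v ∧ H.Adj v w
      symm := ⟨fun v w h => ⟨h.1.trans h.2.reachable, h.2.symm⟩⟩
      loopless := ⟨fun v h => H.loopless.irrefl v h.2⟩ }
  have hdeg : ∀ v, H.Reachable x v → K.degree v = H.degree v := fun v hv => by
    unfold SimpleGraph.degree
    congr 1
    ext w
    simp [K, hv]
  obtain ⟨y, hy, hodd⟩ := K.exists_ne_odd_degree_of_exists_odd_degree x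
    (by rwa [hdeg x (Reachable.refl x)])
  obtain ⟨w, hw⟩ := (K.degree_pos_iff_exists_adj y).mp hodd.pos
  exact ⟨y, hy, hw.1, hdeg y hw.1 ▸ hodd⟩

theorem degree_eq_one_of_exposed {V : Type*} [DecidableEq V] {G : SimpleGraph V}
    {M N : Finset (Sym2 V)} (hN : IsMatching G N) {x : V}
    [Fintype (fromEdgeSet ((M ∆ N : Finset (Sym2 V)) : Set (Sym2 V)) |>.neighborSet x)]
    (hxM : ¬ Matched M x) (hxN : Matched N x) :
    (fromEdgeSet ((M ∆ N : Finset (Sym2 V)) : Set (Sym2 V))).degree x = 1 := by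
  obtain ⟨e, he, hxe⟩ := hxN
  obtain ⟨y, rfl⟩ := Sym2.mem_iff_exists.mp hxe
  rw [degree_eq_one_iff_existsUnique_adj]
  have hM : ∀ w, s(x, w) ∉ M := fun w h => hxM ⟨_, h, by simp⟩
  refine ⟨y, ?_, fun w hw => ?_⟩
  · simp only [fromEdgeSet_adj, Finset.mem_coe, Finset.mem_symmDiff]
    exact ⟨Or.inr ⟨he, hM y⟩, (hN.1 he : G.Adj x y).ne⟩
  · simp only [fromEdgeSet_adj, Finset.mem_coe, Finset.mem_symmDiff] at hw
    have : s(x, w) ∈ N := by have := hM w; tauto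
    exact Sym2.congr_right.mp (hN.eq_of_mem this he (v := x) (by simp) (by simp))

theorem exposed_of_odd_degree {V : Type*} [DecidableEq V] {G : SimpleGraph V}
    {M N : Finset (Sym2 V)} (hM : IsMatching G M) (hN : IsMatching G N)
    (hMN : ∀ v, Matched M v → Matched N v) {x : V}
    [Fintype (fromEdgeSet ((M ∆ N : Finset (Sym2 V)) : Set (Sym2 V)) |>.neighborSet x)]
    (hx : Odd ((fromEdgeSet ((M ∆ N : Finset (Sym2 V)) : Set (Sym2 V))).degree x)) :
    ¬ Matched M x := by
  intro hxM
  obtain ⟨f, hf, hxf⟩ := hMN x hxM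
  obtain ⟨e, he, hxe⟩ := hxM
  obtain ⟨y, rfl⟩ := Sym2.mem_iff_exists.mp hxe
  obtain ⟨z, rfl⟩ := Sym2.mem_iff_exists.mp hxf
  have hM' : ∀ w, s(x, w) ∈ M ↔ w = y := fun w =>
    ⟨fun h => Sym2.congr_right.mp (hM.eq_of_mem h he (v := x) (by simp) (by simp)), fun h => h ▸ he⟩
  have hN' : ∀ w, s(x, w) ∈ N ↔ w = z := fun w =>
    ⟨fun h => Sym2.congr_right.mp (hN.eq_of_mem h hf (v := x) (by simp) (by simp)), fun h => h ▸ hf⟩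
  have hxy : x ≠ y := (hM.1 he : G.Adj x y).ne
  have hxz : x ≠ z := (hN.1 hf : G.Adj x z).ne
  have hnb : (fromEdgeSet ((M ∆ N : Finset (Sym2 V)) : Set (Sym2 V))).neighborFinset x
      = if y = z then ∅ else {y, z} := by
    ext w
    simp only [mem_neighborFinset, fromEdgeSet_adj, Finset.mem_coe, Finset.mem_symmDiff, hM', hN']
    split_ifs <;> simp <;> grind
  rw [← card_neighborFinset_eq_degree, hnb] at hx
  split_ifs at hx with h
  · simp at hx
  · rw [Finset.card_pair h] at hx
    exact absurd hx (by decide)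

/-- If every vertex matched by `M` is matched by `N`, then from each vertex matched by `N` only
there is an augmenting path inside `M ∆ N`. -/
theorem exists_isAugPath_of_matched {V : Type*} [Fintype V] [DecidableEq V] {G : SimpleGraph V}
    {M N : Finset (Sym2 V)} (hM : IsMatching G M) (hN : IsMatching G N)
    (hMN : ∀ v, Matched M v → Matched N v) {x : V} (hxM : ¬ Matched M x) (hxN : Matched N x) :
    ∃ (y : V) (p : G.Walk x y), IsAugPath G M p ∧ p.edges.toFinset ⊆ M ∆ N := by
  have hodd : Odd ((fromEdgeSet ((M ∆ N : Finset (Sym2 V)) : Set (Sym2 V))).degree x) := by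
    rw [degree_eq_one_of_exposed hN hxM hxN]
    exact odd_one
  obtain ⟨y, hyx, hreach, hy⟩ := SimpleGraph.exists_ne_reachable_odd_degree _ hodd
  have hyM := exposed_of_odd_degree hM hN hMN hy
  clear hy hodd
  set H := fromEdgeSet ((M ∆ N : Finset (Sym2 V)) : Set (Sym2 V)) with hH
  have hsub : H.edgeSet ⊆ ((M ∆ N : Finset (Sym2 V)) : Set (Sym2 V)) := by
    rw [hH, edgeSet_fromEdgeSet]
    exact Set.sdiff_subset
  have hle : H ≤ G := by
    rw [← edgeSet_subset_edgeSet]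
    intro e he
    rcases Finset.mem_symmDiff.mp (hsub he) with h | h
    · exact hM.1 h.1
    · exact hN.1 h.1
  obtain ⟨w⟩ := hreach
  have hw := w.bypass_isPath
  refine ⟨y, w.bypass.mapLe hle, ⟨hw.mapLe hle, ?_, hxM, hyM, ?_⟩, ?_⟩
  · rw [Walk.length_mapLe, Nat.pos_iff_ne_zero]
    exact fun h => hyx (Walk.eq_of_length_eq_zero h).symm
  · rw [Walk.edges_mapLe_eq_edges]
    exact alternating_of_isPath hM hN hsub hw
  · intro e he
    rw [List.mem_toFinset, Walk.edges_mapLe_eq_edges] at he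
    exact hsub (w.bypass.edges_subset_edgeSet he)

/-- An augmenting path inside `M ∆ N` contains every edge of `M ∆ N` that meets it. -/
theorem IsAugPath.mem_edges_of_mem_symmDiff {V : Type*} [DecidableEq V] {G : SimpleGraph V}
    {M N : Finset (Sym2 V)} (hM : IsMatching G M) (hN : IsMatching G N) {a b : V}
    {p : G.Walk a b} (hp : IsAugPath G M p) (hpD : p.edges.toFinset ⊆ M ∆ N) {v : V}
    (hv : v ∈ p.support) {g : Sym2 V} (hg : g ∈ M ∆ N) (hvg : v ∈ g) : g ∈ p.edges := by
  obtain ⟨-, hMp, e, he, heM, hve, -⟩ := hp.exists_edges_at hM hv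
  have heD := hpD (List.mem_toFinset.mpr he)
  rw [Finset.mem_symmDiff] at hg heD
  rcases hg with hg | hg
  · exact hMp g hg.1 hvg
  · rwa [hN.eq_of_mem hg.1 (by tauto : e ∈ N) hvg hve]

theorem SimpleGraph.Walk.start_mem_of_mem_support {V : Type*} {G : SimpleGraph V} {S : Set V}
    {x y : V} (p : G.Walk x y) (hS : ∀ v w, s(v, w) ∈ p.edges → w ∈ S → v ∈ S)
    {v : V} (hv : v ∈ p.support) (hvS : v ∈ S) : x ∈ S := by
  induction p with
  | nil => simp_all
  | cons h q ih =>
    rcases List.mem_cons.mp (Walk.support_cons h q ▸ hv) with rfl | hv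
    · exact hvS
    · exact hS _ _ (by simp) (ih (fun v w he => hS v w (by simp [he])) hv)

theorem IsAugPath.disjoint_support {V : Type*} [DecidableEq V] {G : SimpleGraph V}
    {M N : Finset (Sym2 V)} (hM : IsMatching G M) (hN : IsMatching G N) {a b x y : V}
    {p : G.Walk a b} (hp : IsAugPath G M p) (hpD : p.edges.toFinset ⊆ M ∆ N)
    {q : G.Walk x y} (hq : IsAugPath G M q) (hqD : q.edges.toFinset ⊆ M ∆ N)
    (hxa : x ≠ a) (hxb : x ≠ b) {v : V} (hvp : v ∈ p.support) : v ∉ q.support := by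
  intro hvq
  have hx : x ∈ p.support := q.start_mem_of_mem_support (S := {w | w ∈ p.support})
    (fun v w he hw => p.fst_mem_support_of_mem_edges
      (hp.mem_edges_of_mem_symmDiff hM hN hpD hw (hqD (List.mem_toFinset.mpr he)) (by simp)))
    hvq hvp
  rcases (hp.exists_edges_at hM hx).1 with h | h | h
  exacts [hxa h, hxb h, hq.expA h]

theorem SimpleGraph.Walk.IsPath.card_edges_toFinset {V : Type*} [DecidableEq V]
    {G : SimpleGraph V} {a b : V} {p : G.Walk a b} (hp : p.IsPath) :
    p.edges.toFinset.card = p.length := by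
  rw [List.toFinset_card_of_nodup hp.isTrail.edges_nodup, Walk.length_edges]

theorem IsAugPath.ne {V : Type*} {G : SimpleGraph V} {M : Finset (Sym2 V)} {a b : V}
    {p : G.Walk a b} (hp : IsAugPath G M p) : a ≠ b := by
  rintro rfl
  exact hp.pos.ne' (by rw [(Walk.isPath_iff_nil.mp hp.isPath).eq_nil]; rfl)

end

/-- Vertex-arrival invariant step: let `M` be a matching, `k` a positive even
integer, and `u` an exposed vertex. If every augmenting path with respect to `M`
not containing `u` has length at least `k + 1`, and `P` is a shortest augmenting
path with respect to `M` among those containing `u`, then every augmenting path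
with respect to `M △ P` has length at least `k + 1`. -/
theorem stmt7 {V : Type*} [Fintype V] [DecidableEq V] (G : SimpleGraph V)
    (M : Finset (Sym2 V)) (hM : IsMatching G M)
    (k : ℕ) (hk0 : 0 < k) (hk2 : Even k)
    (u : V) (hu : ¬ Matched M u)
    (hothers : ∀ (x y : V) (q : G.Walk x y), IsAugPath G M q → u ∉ q.support →
      k + 1 ≤ q.length)
    {a b : V} (P : G.Walk a b) (hP : IsAugPath G M P) (huP : u ∈ P.support)
    (hmin : ∀ (x y : V) (q : G.Walk x y), IsAugPath G M q → u ∈ q.support →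
      P.length ≤ q.length) :
    ∀ (c d : V) (Q : G.Walk c d), IsAugPath G (M ∆ P.edges.toFinset) Q →
      k + 1 ≤ Q.length := by
  intro c d Q hQ
  have hM' := hP.isMatching_symmDiff hM
  have hN := hQ.isMatching_symmDiff hM'
  have hN' := fun v => (hQ.matched_symmDiff_iff hM' v).trans
    (or_congr_left (hP.matched_symmDiff_iff hM v))
  have hc := mt (hP.matched_symmDiff_iff hM c).mpr hQ.expA
  have hd := mt (hP.matched_symmDiff_iff hM d).mpr hQ.expB
  have hD : M ∆ ((M ∆ P.edges.toFinset) ∆ Q.edges.toFinset)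
      = P.edges.toFinset ∆ Q.edges.toFinset := by
    rw [symmDiff_assoc, symmDiff_symmDiff_cancel_left]
  set N := (M ∆ P.edges.toFinset) ∆ Q.edges.toFinset
  have hMN : ∀ v, Matched M v → Matched N v := fun v h => (hN' v).mpr (Or.inl (Or.inl h))
  have huab : u = a ∨ u = b := by
    have := (hP.exists_edges_at hM huP).1
    tauto
  obtain ⟨y, R, hR, hRD⟩ :=
    exists_isAugPath_of_matched hM hN hMN hu ((hN' u).mpr (Or.inl (Or.inr huab)))
  obtain ⟨z, hzM, hzN, hzu, hzy⟩ :
      ∃ z, ¬ Matched M z ∧ Matched N z ∧ z ≠ u ∧ z ≠ y := by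
    have hcd := hQ.ne
    have hcN := (hN' c).mpr (by tauto)
    have hdN := (hN' d).mpr (by tauto)
    by_cases h : c = y
    · exact ⟨d, by tauto, hdN, by grind, by grind⟩
    · exact ⟨c, by tauto, hcN, by grind, h⟩
  obtain ⟨w, S, hS, hSD⟩ := exists_isAugPath_of_matched hM hN hMN hzM hzN
  have hdisj := fun v => hR.disjoint_support hM hN hRD hS hSD hzu hzy (v := v)
  have hR' := hmin _ _ R hR R.start_mem_support
  have hS' := hothers _ _ S hS (hdisj u R.start_mem_support)
  have hedges : Disjoint R.edges.toFinset S.edges.toFinset := by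
    rw [Finset.disjoint_left]
    intro e heR heS
    induction e with
    | _ v v' =>
      exact hdisj v (R.fst_mem_support_of_mem_edges (List.mem_toFinset.mp heR))
        (S.fst_mem_support_of_mem_edges (List.mem_toFinset.mp heS))
  have hcard := Finset.card_le_card (Finset.union_subset hRD hSD)
  have hcard' : (P.edges.toFinset ∆ Q.edges.toFinset).card
      ≤ P.edges.toFinset.card + Q.edges.toFinset.card :=
    (Finset.card_le_card symmDiff_le_sup).trans (Finset.card_union_le _ _)
  rw [Finset.card_union_of_disjoint hedges, hD, hR.isPath.card_edges_toFinset,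
    hS.isPath.card_edges_toFinset] at hcard
  rw [hP.isPath.card_edges_toFinset, hQ.isPath.card_edges_toFinset] at hcard'
  omega
end

section
/- Let k be a positive even integer. Let G be a finite simple graph whose edges are enumerated as e₁, …, e_m, and for 0 ≤ t ≤ m let Gₜ be the subgraph of G with edge set {e₁, …, eₜ}. Let M₀ = ∅, and for each 1 ≤ t ≤ m suppose the matching Mₜ in Gₜ satisfies: if there exists an augmenting path in Gₜ with respect to M_{t−1} that contains the edge eₜ and has length at most k − 1, then Mₜ = M_{t−1}△Pₜ for some such path Pₜ of minimum length among augmenting paths with respect to M_{t−1} containing eₜ; otherwise Mₜ = M_{t−1}. Then for every 0 ≤ t ≤ m, every augmenting path in Gₜ with respect to Mₜ has length at least k + 1, and in particular |M_m| ≥ (1 − 2/(k + 2)) · ν(G), where ν(G) is the maximum cardinality of a matching in G. -/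
open scoped Classical symmDiff

namespace IsMatching

variable {V : Type*} {G : SimpleGraph V} {M N : Finset (Sym2 V)} {a b v : V}

theorem subset (hM : IsMatching G M) (h : N ⊆ M) : IsMatching G N :=
  ⟨fun _ hf => hM.1 (h hf), fun e he f hf => hM.2 e (h he) f (h hf)⟩

theorem eq_of_mem_s10 (hM : IsMatching G M) {e f : Sym2 V} (he : e ∈ M) (hf : f ∈ M)
    (hve : v ∈ e) (hvf : v ∈ f) : e = f := by
  by_contra hne
  exact hM.2 e he f hf hne v hve hvf

theorem not_matched_erase [DecidableEq V] (hM : IsMatching G M) {e : Sym2 V} (he : e ∈ M)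
    (hv : v ∈ e) : ¬ Matched (M.erase e) v := by
  rintro ⟨f, hf, hvf⟩
  rw [Finset.mem_erase] at hf
  exact hf.1 (hM.eq_of_mem_s10 hf.2 he hvf hv)

theorem insert [DecidableEq V] (hM : IsMatching G M) (hab : G.Adj a b) (ha : ¬ Matched M a)
    (hb : ¬ Matched M b) :
    IsMatching G (insert s(a, b) M) ∧ (insert s(a, b) M).card = M.card + 1 := by
  have key : ∀ f ∈ M, ∀ v ∈ s(a, b), v ∉ f := by
    intro f hf v hv hvf
    rcases Sym2.mem_iff.1 hv with rfl | rfl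
    · exact ha ⟨f, hf, hvf⟩
    · exact hb ⟨f, hf, hvf⟩
  refine ⟨⟨?_, ?_⟩, Finset.card_insert_of_notMem fun h => ha ⟨_, h, Sym2.mem_mk_left a b⟩⟩
  · intro f hf
    rcases Finset.mem_insert.1 hf with rfl | hf
    · exact hab
    · exact hM.1 hf
  · intro e he f hf hne v hve hvf
    rcases Finset.mem_insert.1 he with rfl | he <;> rcases Finset.mem_insert.1 hf with rfl | hf
    · exact hne rfl
    · exact key f hf v hve hvf
    · exact key e he v hvf hve
    · exact hM.2 e he f hf hne v hve hvf

theorem card_biUnion_toFinset [DecidableEq V] (hM : IsMatching G M) :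
    (M.biUnion Sym2.toFinset).card = 2 * M.card := by
  rw [Finset.card_biUnion, Finset.sum_congr rfl fun e he =>
    Sym2.card_toFinset_of_not_isDiag e (G.not_isDiag_of_mem_edgeSet (hM.1 he))]
  · simp [mul_comm]
  · intro e he f hf hne
    rw [Function.onFun, Finset.disjoint_left]
    intro v hve hvf
    exact hM.2 e he f hf hne v (Sym2.mem_toFinset.1 hve) (Sym2.mem_toFinset.1 hvf)

theorem exists_matched_not_matched [DecidableEq V] (hM : IsMatching G M) (hN : IsMatching G N)
    (h : M.card < N.card) : ∃ v, Matched N v ∧ ¬ Matched M v := by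
  by_contra! hcon
  have hsub : N.biUnion Sym2.toFinset ⊆ M.biUnion Sym2.toFinset := by
    intro v hv
    simp only [Finset.mem_biUnion, Sym2.mem_toFinset] at hv ⊢
    exact hcon v hv
  have := Finset.card_le_card hsub
  rw [hM.card_biUnion_toFinset, hN.card_biUnion_toFinset] at this
  omega

end IsMatching

theorem Matched.mono {V : Type*} {M N : Finset (Sym2 V)} (h : M ⊆ N) {v : V}
    (hv : Matched M v) : Matched N v :=
  let ⟨e, he, hve⟩ := hv
  ⟨e, h he, hve⟩

section Alternating

variable {V : Type*} {M M' : Finset (Sym2 V)} {l : List (Sym2 V)}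

theorem alternating_iff_isChain :
    Alternating M l ↔ l.IsChain fun e f => e ∈ M ↔ f ∉ M := by
  rw [List.isChain_iff_getElem, Alternating]

theorem alternating_cons_cons {e f : Sym2 V} :
    Alternating M (e :: f :: l) ↔ (e ∈ M ↔ f ∉ M) ∧ Alternating M (f :: l) := by
  simp only [alternating_iff_isChain, List.isChain_cons_cons]

theorem Alternating.tail {e : Sym2 V} (h : Alternating M (e :: l)) : Alternating M l := by
  rw [alternating_iff_isChain] at h ⊢
  exact List.IsChain.tail h

theorem Alternating.reverse (h : Alternating M l) : Alternating M l.reverse := by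
  rw [alternating_iff_isChain] at h ⊢
  rw [List.isChain_reverse]
  exact h.imp fun e f hef => by tauto

theorem Alternating.congr (h : Alternating M l) (hl : ∀ e ∈ l, e ∈ M ↔ e ∈ M') :
    Alternating M' l := fun i hi => by
  rw [← hl _ (List.getElem_mem _), ← hl _ (List.getElem_mem _)]
  exact h i hi

/-- Internal vertices of an alternating walk are matched. -/
theorem Alternating.matched {G : SimpleGraph V} {a b v : V} {p : G.Walk a b}
    (h : Alternating M p.edges) (hv : v ∈ p.support) (hva : v ≠ a) (hvb : v ≠ b) :
    Matched M v := by
  induction p with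
  | nil => simp_all
  | @cons a c b hac p ih =>
    have hv' : v ∈ p.support := by simpa [hva] using hv
    rw [SimpleGraph.Walk.edges_cons] at h
    by_cases hvc : v = c
    · subst hvc
      cases p with
      | nil => exact absurd rfl hvb
      | @cons _ d _ hvd q =>
        rw [SimpleGraph.Walk.edges_cons, alternating_cons_cons] at h
        by_cases hmem : s(a, v) ∈ M
        · exact ⟨_, hmem, Sym2.mem_mk_right a v⟩
        · exact ⟨s(v, d), by tauto, Sym2.mem_mk_left v d⟩
    · exact ih h.tail hv' hvc hvb

end Alternating

theorem symmDiff_insert_insert {α : Type*} [DecidableEq α] {X s : Finset α} {x y : α}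
    (hx : x ∉ X) (hy : y ∈ X) (hys : y ∉ s) :
    X ∆ insert x (insert y s) = insert x (X.erase y ∆ s) := by
  ext f
  simp only [Finset.mem_symmDiff, Finset.mem_insert, Finset.mem_erase]
  grind

theorem symmDiff_singleton_of_notMem {α : Type*} [DecidableEq α] {X : Finset α} {x : α}
    (hx : x ∉ X) : X ∆ {x} = insert x X := by
  ext f
  simp only [Finset.mem_symmDiff, Finset.mem_insert, Finset.mem_singleton]
  grind

namespace IsAugPath

open SimpleGraph

variable {V : Type*} {G : SimpleGraph V} {M : Finset (Sym2 V)} {a b : V} {p : G.Walk a b}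

theorem reverse (hp : IsAugPath G M p) : IsAugPath G M p.reverse where
  isPath := hp.isPath.reverse
  pos := by simpa using hp.pos
  expA := hp.expB
  expB := hp.expA
  alt := by simpa using hp.alt.reverse

theorem card_toFinset_edges [DecidableEq V] (hp : IsAugPath G M p) :
    p.edges.toFinset.card = p.length := by
  rw [List.toFinset_card_of_nodup hp.isPath.isTrail.edges_nodup, Walk.length_edges]

theorem transfer {H : SimpleGraph V} (hp : IsAugPath G M p)
    (h : ∀ e ∈ p.edges, e ∈ H.edgeSet) : IsAugPath H M (p.transfer H h) where
  isPath := hp.isPath.transfer h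
  pos := by simpa using hp.pos
  expA := hp.expA
  expB := hp.expB
  alt := by simpa using hp.alt

/-- Vertices outside the path keep their status after augmenting. -/
theorem _root_.not_matched_symmDiff_edges [DecidableEq V] {v : V} (hv : ¬ Matched M v)
    (hvp : v ∉ p.support) : ¬ Matched (M ∆ p.edges.toFinset) v := by
  rintro ⟨f, hf, hvf⟩
  rw [Finset.mem_symmDiff, List.mem_toFinset] at hf
  rcases hf with hf | hf
  · exact hv ⟨f, hf.1, hvf⟩
  · exact hvp (Walk.mem_support_of_mem_edges hf.1 hvf)

/-- Augmenting along a path produces a matching with one more edge, and augmenting paths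
have odd length. -/
theorem augment [DecidableEq V] (hM : IsMatching G M) (hp : IsAugPath G M p) :
    IsMatching G (M ∆ p.edges.toFinset) ∧ (M ∆ p.edges.toFinset).card = M.card + 1 ∧
      Odd p.length := by
  induction hn : p.length using Nat.strong_induction_on generalizing a b p M with
  | _ n ih =>
  subst hn
  match p, hp with
  | .nil, hp => simpa using hp.pos
  | .cons hab .nil, hp =>
    have hmem : s(a, b) ∉ M := fun h => hp.expA ⟨_, h, Sym2.mem_mk_left _ _⟩
    have := hM.insert hab hp.expA hp.expB
    simpa [symmDiff_singleton_of_notMem hmem] using this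
  | .cons (v := b') hab (.cons (v := c) hbc q), hp =>
    have hpath := hp.isPath
    have halt := hp.alt
    simp only [Walk.cons_isPath_iff, Walk.support_cons, List.mem_cons, not_or] at hpath
    obtain ⟨⟨hq, hbq⟩, hane, haq⟩ := hpath
    simp only [Walk.edges_cons, alternating_cons_cons] at halt
    have hab_mem : s(a, b') ∉ M := fun h => hp.expA ⟨_, h, Sym2.mem_mk_left _ _⟩
    have hbc_mem : s(b', c) ∈ M := by tauto
    have hbc_q : s(b', c) ∉ q.edges := fun h => hbq (Walk.fst_mem_support_of_mem_edges q h)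
    have hM' := hM.subset (M.erase_subset s(b', c))
    have hq' : IsAugPath G (M.erase s(b', c)) q :=
      { isPath := hq
        pos := by
          rcases Nat.eq_zero_or_pos q.length with h0 | h0
          · have := Walk.eq_of_length_eq_zero h0
            subst this
            exact absurd ⟨_, hbc_mem, Sym2.mem_mk_right _ _⟩ hp.expB
          · exact h0
        expA := hM.not_matched_erase hbc_mem (Sym2.mem_mk_right _ _)
        expB := fun h => hp.expB (h.mono (M.erase_subset _))
        alt := halt.2.tail.congr fun e he => by
          rw [Finset.mem_erase]
          exact ⟨fun h => ⟨fun h' => hbc_q (h' ▸ he), h⟩, fun h => h.2⟩ }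
    obtain ⟨h1, h2, h3⟩ := ih q.length (by simp) hM' hq' rfl
    have h4 := h1.insert hab
      (not_matched_symmDiff_edges (fun h => hp.expA (h.mono (M.erase_subset _))) haq)
      (not_matched_symmDiff_edges (hM.not_matched_erase hbc_mem (Sym2.mem_mk_left _ _)) hbq)
    simp only [Walk.edges_cons, List.toFinset_cons, Walk.length_cons]
    rw [symmDiff_insert_insert hab_mem hbc_mem (by simpa using hbc_q)]
    refine ⟨h4.1, ?_, ?_⟩
    · rw [h4.2, h2, Finset.card_erase_add_one hbc_mem]
    · obtain ⟨r, hr⟩ := h3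
      exact ⟨r + 1, by omega⟩

end IsAugPath

theorem symmDiff_eq_insert_erase {α : Type*} [DecidableEq α] {X s : Finset α} {y : α}
    (hy : y ∈ X) (hys : y ∉ s) : X ∆ s = insert y (X.erase y ∆ s) := by
  ext f
  simp only [Finset.mem_symmDiff, Finset.mem_insert, Finset.mem_erase]
  grind

/-- `p` is an `M`-augmenting path inside `M ∆ N`, and switching `N` along `p` yields a matching
with one edge fewer which leaves both ends of `p` exposed. -/
structure IsDetachable {V : Type*} [DecidableEq V] (G : SimpleGraph V) (M N : Finset (Sym2 V))
    {a b : V} (p : G.Walk a b) : Prop where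
  aug : IsAugPath G M p
  sub : ∀ f ∈ p.edges, f ∈ M ∆ N
  matching : IsMatching G (N ∆ p.edges.toFinset)
  card : (N ∆ p.edges.toFinset).card + 1 = N.card
  startFree : ¬ Matched (N ∆ p.edges.toFinset) a
  endFree : ¬ Matched (N ∆ p.edges.toFinset) b

namespace IsDetachable

open SimpleGraph

variable {V : Type*} [DecidableEq V] {G : SimpleGraph V} {M N : Finset (Sym2 V)}
  {a b c u z v : V} {p : G.Walk u z}

theorem reverse (hp : IsDetachable G M N p) : IsDetachable G M N p.reverse where
  aug := hp.aug.reverse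
  sub := by simpa using hp.sub
  matching := by simpa using hp.matching
  card := by simpa using hp.card
  startFree := by simpa using hp.endFree
  endFree := by simpa using hp.startFree

theorem notMem_support (hp : IsDetachable G M N p) (hM : ¬ Matched M v) (hN : ¬ Matched N v) :
    v ∉ p.support := by
  intro hv
  rw [Walk.mem_support_iff_exists_mem_edges_of_not_nil
    (by rw [← Walk.length_eq_zero_iff]; exact hp.aug.pos.ne')] at hv
  obtain ⟨f, hf, hvf⟩ := hv
  have := hp.sub f hf
  rw [Finset.mem_symmDiff] at this
  rcases this with h | h
  · exact hM ⟨f, h.1, hvf⟩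
  · exact hN ⟨f, h.1, hvf⟩

theorem single (hab : G.Adj a b) (hN : IsMatching G N) (habN : s(a, b) ∈ N)
    (ha : ¬ Matched M a) (hb : ¬ Matched M b) : IsDetachable G M N (.cons hab .nil) := by
  have habM : s(a, b) ∉ M := fun h => ha ⟨_, h, Sym2.mem_mk_left _ _⟩
  have heq : N ∆ (Walk.cons hab .nil : G.Walk a b).edges.toFinset = N.erase s(a, b) := by
    ext f
    simp only [Walk.edges_cons, Walk.edges_nil, List.toFinset_cons, List.toFinset_nil,
      Finset.mem_symmDiff, Finset.mem_insert, Finset.mem_erase]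
    grind
  refine ⟨⟨by simpa using hab.ne, by simp, ha, hb, fun i hi => by simp at hi⟩, ?_, ?_, ?_, ?_, ?_⟩
  · simp [Finset.mem_symmDiff, habN, habM]
  all_goals rw [heq]
  · exact hN.subset (N.erase_subset _)
  · exact Finset.card_erase_add_one habN
  · exact hN.not_matched_erase habN (Sym2.mem_mk_left _ _)
  · exact hN.not_matched_erase habN (Sym2.mem_mk_right _ _)

theorem sub_of_erase (hp : IsDetachable G (M.erase s(b, c)) (N.erase s(a, b)) p)
    (hap : a ∉ p.support) (hbp : b ∉ p.support) : ∀ f ∈ p.edges, f ∈ M ∆ N := by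
  intro f hf
  have h1 : f ≠ s(a, b) := fun h => hap (Walk.fst_mem_support_of_mem_edges p (h ▸ hf))
  have h2 : f ≠ s(b, c) := fun h => hbp (Walk.fst_mem_support_of_mem_edges p (h ▸ hf))
  have := hp.sub f hf
  simp only [Finset.mem_symmDiff, Finset.mem_erase] at this ⊢
  tauto

theorem alternating_of_erase (hp : IsDetachable G (M.erase s(b, c)) N p)
    (hbp : b ∉ p.support) : Alternating M p.edges := by
  refine hp.aug.alt.congr fun f hf => ?_
  have h2 : f ≠ s(b, c) := fun h => hbp (Walk.fst_mem_support_of_mem_edges p (h ▸ hf))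
  simp [h2]

theorem matched_erase (hv : Matched M v) (hvb : v ≠ b) (hvc : v ≠ c) :
    Matched (M.erase s(b, c)) v := by
  obtain ⟨f, hf, hvf⟩ := hv
  refine ⟨f, Finset.mem_erase.2 ⟨?_, hf⟩, hvf⟩
  rintro rfl
  rcases Sym2.mem_iff.1 hvf with h | h
  exacts [hvb h, hvc h]

theorem of_erase (hM : IsMatching G M) (hN : IsMatching G N) (ha : ¬ Matched M a)
    (habN : s(a, b) ∈ N) (hbcM : s(b, c) ∈ M) (huc : u ≠ c) (hzc : z ≠ c)
    (hp : IsDetachable G (M.erase s(b, c)) (N.erase s(a, b)) p) : IsDetachable G M N p := by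
  have haM : ¬ Matched (M.erase s(b, c)) a := fun h => ha (h.mono (M.erase_subset _))
  have haN := hN.not_matched_erase habN (Sym2.mem_mk_left _ _)
  have hbM := hM.not_matched_erase hbcM (Sym2.mem_mk_left _ _)
  have hbN := hN.not_matched_erase habN (Sym2.mem_mk_right _ _)
  have hap := hp.notMem_support haM haN
  have hbp := hp.notMem_support hbM hbN
  have hcp : c ∉ p.support := fun h =>
    hM.not_matched_erase hbcM (Sym2.mem_mk_right _ _) (hp.aug.alt.matched h huc.symm hzc.symm)
  have hub : u ≠ b := fun h => hbp (h ▸ p.start_mem_support)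
  have hzb : z ≠ b := fun h => hbp (h ▸ p.end_mem_support)
  have hua : u ≠ a := fun h => hap (h ▸ p.start_mem_support)
  have hza : z ≠ a := fun h => hap (h ▸ p.end_mem_support)
  have hedge : s(a, b) ∉ p.edges.toFinset := fun h =>
    hap (Walk.fst_mem_support_of_mem_edges p (List.mem_toFinset.1 h))
  have hins := hp.matching.insert (hN.1 habN) (not_matched_symmDiff_edges haN hap)
    (not_matched_symmDiff_edges hbN hbp)
  rw [← symmDiff_eq_insert_erase habN hedge] at hins
  have hfree : ∀ v, v ≠ a → v ≠ b → ¬ Matched (N.erase s(a, b) ∆ p.edges.toFinset) v →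
      ¬ Matched (N ∆ p.edges.toFinset) v := by
    rintro v hva hvb hv ⟨f, hf, hvf⟩
    rw [symmDiff_eq_insert_erase habN hedge, Finset.mem_insert] at hf
    rcases hf with rfl | hf
    · rcases Sym2.mem_iff.1 hvf with h | h
      exacts [hva h, hvb h]
    · exact hv ⟨f, hf, hvf⟩
  exact
    { aug :=
        { isPath := hp.aug.isPath
          pos := hp.aug.pos
          expA := fun h => hp.aug.expA (matched_erase h hub huc)
          expB := fun h => hp.aug.expB (matched_erase h hzb hzc)
          alt := hp.alternating_of_erase hbp }
      sub := hp.sub_of_erase hap hbp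
      matching := hins.1
      card := by rw [hins.2, hp.card, Finset.card_erase_add_one habN]
      startFree := hfree u hua hub hp.startFree
      endFree := hfree z hza hzb hp.endFree }

theorem cons_cons (hM : IsMatching G M) (hN : IsMatching G N) (ha : ¬ Matched M a)
    (hab : G.Adj a b) (hbc : G.Adj b c) (habN : s(a, b) ∈ N) (hbcM : s(b, c) ∈ M)
    {p : G.Walk c z} (hp : IsDetachable G (M.erase s(b, c)) (N.erase s(a, b)) p) :
    IsDetachable G M N (.cons hab (.cons hbc p)) := by
  have hca : c ≠ a := fun h => ha ⟨_, hbcM, h ▸ Sym2.mem_mk_right _ _⟩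
  have habM : s(a, b) ∉ M := fun h => ha ⟨_, h, Sym2.mem_mk_left _ _⟩
  have hbcN : s(b, c) ∉ N := fun h => by
    have := hN.eq_of_mem_s10 habN h (Sym2.mem_mk_right _ _) (Sym2.mem_mk_left _ _)
    rw [Sym2.eq_swap, Sym2.congr_right] at this
    exact hca this.symm
  have haM : ¬ Matched (M.erase s(b, c)) a := fun h => ha (h.mono (M.erase_subset _))
  have haN := hN.not_matched_erase habN (Sym2.mem_mk_left _ _)
  have hbM := hM.not_matched_erase hbcM (Sym2.mem_mk_left _ _)
  have hbN := hN.not_matched_erase habN (Sym2.mem_mk_right _ _)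
  have hap := hp.notMem_support haM haN
  have hbp := hp.notMem_support hbM hbN
  have hzb : z ≠ b := fun h => hbp (h ▸ p.end_mem_support)
  have hzc : z ≠ c := by
    rintro rfl
    have := hp.aug.pos
    exact this.ne' (Walk.length_eq_zero_iff.2 (Walk.isPath_iff_nil.1 hp.aug.isPath))
  have hedge : s(a, b) ∉ p.edges.toFinset := fun h =>
    hap (Walk.fst_mem_support_of_mem_edges p (List.mem_toFinset.1 h))
  have hins := hp.matching.insert hbc (not_matched_symmDiff_edges hbN hbp) hp.startFree
  have heq : N ∆ (Walk.cons hab (.cons hbc p)).edges.toFinset =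
      insert s(b, c) (N.erase s(a, b) ∆ p.edges.toFinset) := by
    rw [Walk.edges_cons, Walk.edges_cons, List.toFinset_cons, List.toFinset_cons,
      Finset.insert_comm, symmDiff_insert_insert hbcN habN hedge]
  have hfree : ∀ v, v ≠ b → v ≠ c → ¬ Matched (N.erase s(a, b) ∆ p.edges.toFinset) v →
      ¬ Matched (insert s(b, c) (N.erase s(a, b) ∆ p.edges.toFinset)) v := by
    rintro v hvb hvc hv ⟨f, hf, hvf⟩
    rw [Finset.mem_insert] at hf
    rcases hf with rfl | hf
    · rcases Sym2.mem_iff.1 hvf with h | h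
      exacts [hvb h, hvc h]
    · exact hv ⟨f, hf, hvf⟩
  refine ⟨⟨?_, by simp, ha, fun h => hp.aug.expB (matched_erase h hzb hzc), ?_⟩, ?_, ?_, ?_, ?_, ?_⟩
  · simp [Walk.cons_isPath_iff, hp.aug.isPath, hap, hbp, hab.ne]
  · rw [Walk.edges_cons, Walk.edges_cons, alternating_cons_cons]
    refine ⟨by tauto, ?_⟩
    have halt := hp.alternating_of_erase hbp
    cases p with
    | nil => exact absurd rfl hzc
    | @cons _ d _ hcd q =>
      rw [Walk.edges_cons] at halt ⊢
      refine alternating_cons_cons.2 ⟨?_, halt⟩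
      refine iff_of_true hbcM fun h => hbp ?_
      have := hM.eq_of_mem_s10 hbcM h (Sym2.mem_mk_right _ _) (Sym2.mem_mk_left _ _)
      rw [Sym2.eq_swap, Sym2.congr_right] at this
      simp [this]
  · intro f hf
    simp only [Walk.edges_cons, List.mem_cons] at hf
    rcases hf with rfl | rfl | hf
    · exact Finset.mem_symmDiff.2 (Or.inr ⟨habN, habM⟩)
    · exact Finset.mem_symmDiff.2 (Or.inl ⟨hbcM, hbcN⟩)
    · exact hp.sub_of_erase hap hbp f hf
  all_goals rw [heq]
  · exact hins.1
  · rw [hins.2, hp.card, Finset.card_erase_add_one habN]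
  · exact hfree a hab.ne hca.symm (not_matched_symmDiff_edges haN hap)
  · exact hfree z hzb hzc hp.endFree

end IsDetachable

/-- A quantitative form of Berge's lemma. -/
theorem IsMatching.exists_isDetachable {V : Type*} [DecidableEq V] {G : SimpleGraph V}
    {M N : Finset (Sym2 V)} (hM : IsMatching G M) (hN : IsMatching G N) (h : M.card < N.card) :
    ∃ (a b : V) (p : G.Walk a b), IsDetachable G M N p := by
  induction hn : N.card generalizing M N with
  | zero => omega
  | succ n ih =>
    obtain ⟨a, ⟨f, habN, haf⟩, ha⟩ := hM.exists_matched_not_matched hN h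
    obtain ⟨b, rfl⟩ := haf
    by_cases hb : Matched M b
    · obtain ⟨g, hbcM, hbg⟩ := hb
      obtain ⟨c, rfl⟩ := hbg
      have hcN := Finset.card_erase_add_one habN
      have hcM := Finset.card_erase_add_one hbcM
      obtain ⟨u, z, p, hp⟩ := ih (hM.subset (M.erase_subset s(b, c)))
        (hN.subset (N.erase_subset s(a, b))) (by omega) (by omega)
      by_cases huc : u = c
      · subst huc
        exact ⟨_, _, _, hp.cons_cons hM hN ha (hN.1 habN) (hM.1 hbcM) habN hbcM⟩
      by_cases hzc : z = c
      · subst hzc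
        exact ⟨_, _, _, hp.reverse.cons_cons hM hN ha (hN.1 habN) (hM.1 hbcM) habN hbcM⟩
      exact ⟨_, _, _, hp.of_erase hM hN ha habN hbcM huc hzc⟩
    · exact ⟨_, _, _, IsDetachable.single (hN.1 habN) hN habN ha hb⟩

theorem symmDiff_symmDiff_of_subset {α : Type*} [DecidableEq α] {M N s : Finset α}
    (h : s ⊆ M ∆ N) : M ∆ (N ∆ s) = (M ∆ N) \ s := by
  rw [← symmDiff_assoc, symmDiff_of_ge h]

namespace IsDetachable

open SimpleGraph

variable {V : Type*} [DecidableEq V] {G : SimpleGraph V} {M N : Finset (Sym2 V)}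
  {a b : V} {p : G.Walk a b}

theorem symmDiff_eq (hp : IsDetachable G M N p) :
    M ∆ (N ∆ p.edges.toFinset) = (M ∆ N) \ p.edges.toFinset :=
  symmDiff_symmDiff_of_subset fun f hf => hp.sub f (List.mem_toFinset.1 hf)

theorem card_symmDiff (hp : IsDetachable G M N p) :
    (M ∆ (N ∆ p.edges.toFinset)).card + p.length = (M ∆ N).card := by
  rw [hp.symmDiff_eq, ← hp.aug.card_toFinset_edges]
  exact Finset.card_sdiff_add_card_eq_card fun f hf => hp.sub f (List.mem_toFinset.1 hf)

end IsDetachable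

/-- If all augmenting paths are long, then a larger matching differs in many edges. -/
theorem IsMatching.mul_le_card_symmDiff {V : Type*} [DecidableEq V] {G : SimpleGraph V}
    {M N : Finset (Sym2 V)} (hM : IsMatching G M) (hN : IsMatching G N) {L d : ℕ}
    (hL : ∀ (a b : V) (p : G.Walk a b), IsAugPath G M p → L ≤ p.length)
    (hd : M.card + d ≤ N.card) : d * L ≤ (M ∆ N).card := by
  induction d generalizing N with
  | zero => simp
  | succ d ih =>
    obtain ⟨a, b, p, hp⟩ := hM.exists_isDetachable hN (by omega)
    have h1 := ih hp.matching (by have := hp.card; omega)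
    have h2 := hp.card_symmDiff
    have h3 := hL a b p hp.aug
    rw [add_mul, one_mul]
    omega

/-- After augmenting along a path `p`, an augmenting path `q` yields two edge-disjoint augmenting
paths for the original matching inside `p ∆ q`. -/
theorem IsAugPath.exists_two {V : Type*} [DecidableEq V] {G : SimpleGraph V}
    {M : Finset (Sym2 V)} (hM : IsMatching G M) {a b c d : V} {p : G.Walk a b} {q : G.Walk c d}
    (hp : IsAugPath G M p) (hq : IsAugPath G (M ∆ p.edges.toFinset) q) :
    ∃ (a₁ b₁ a₂ b₂ : V) (p₁ : G.Walk a₁ b₁) (p₂ : G.Walk a₂ b₂), IsAugPath G M p₁ ∧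
      IsAugPath G M p₂ ∧ p₁.edges.Disjoint p₂.edges ∧
      p₁.length + p₂.length ≤ p.length + q.length := by
  obtain ⟨hM₁, hc₁, -⟩ := hp.augment hM
  obtain ⟨hN, hc₂, -⟩ := hq.augment hM₁
  obtain ⟨a₁, b₁, p₁, h₁⟩ := hM.exists_isDetachable hN (by omega)
  obtain ⟨a₂, b₂, p₂, h₂⟩ := hM.exists_isDetachable h₁.matching (by have := h₁.card; omega)
  refine ⟨a₁, b₁, a₂, b₂, p₁, p₂, h₁.aug, h₂.aug, ?_, ?_⟩
  · intro f hf₁ hf₂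
    have := h₂.sub f hf₂
    rw [h₁.symmDiff_eq, Finset.mem_sdiff, List.mem_toFinset] at this
    exact this.2 hf₁
  · have e₁ := h₁.card_symmDiff
    have e₂ := h₂.card_symmDiff
    have heq : M ∆ (M ∆ p.edges.toFinset ∆ q.edges.toFinset) =
        p.edges.toFinset ∆ q.edges.toFinset := by
      rw [symmDiff_assoc, symmDiff_symmDiff_cancel_left]
    rw [heq] at e₁
    have e₃ : (p.edges.toFinset ∆ q.edges.toFinset).card ≤ p.length + q.length := by
      rw [← hp.card_toFinset_edges, ← hq.card_toFinset_edges]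
      exact (Finset.card_le_card symmDiff_le_sup).trans (Finset.card_union_le _ _)
    omega

/-- Online matching under edge arrivals with a hard reassignment budget `k`:
the edges `e 0, …, e (m-1)` of `G` arrive one by one, `Gt t` is the subgraph of
`G` with edge set `{e 0, …, e (t-1)}`, and the algorithm augments along a
shortest augmenting path containing the newly arrived edge whenever one of
length at most `k - 1` exists.  Then after every timestep `t` every augmenting
path in `Gt t` with respect to the current matching `M t` has length at least
`k + 1`; in particular the final matching `M m` satisfies
`|M m| ≥ (1 - 2/(k+2)) · ν(G)`. -/
theorem stmt10 {V : Type*} [Fintype V] [DecidableEq V]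
    (k : ℕ) (hk0 : 0 < k) (hk2 : Even k)
    (G : SimpleGraph V) (m : ℕ) (e : Fin m → Sym2 V) (hinj : Function.Injective e)
    (hmem : ∀ i : Fin m, e i ∈ G.edgeSet)
    (hsurj : ∀ f ∈ G.edgeSet, ∃ i : Fin m, e i = f)
    (Gt : ℕ → SimpleGraph V)
    (hGt : ∀ (t : ℕ) (x y : V), (Gt t).Adj x y ↔
      ∃ i : Fin m, (i : ℕ) < t ∧ e i = s(x, y))
    (M : ℕ → Finset (Sym2 V)) (hM0 : M 0 = ∅)
    (hmatch : ∀ t ≤ m, IsMatching (Gt t) (M t))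
    (hstep : ∀ t : Fin m,
      (∃ (a b : V) (p : (Gt ((t : ℕ) + 1)).Walk a b),
          IsAugPath (Gt ((t : ℕ) + 1)) (M t) p ∧ e t ∈ p.edges ∧
          p.length ≤ k - 1 ∧
          (∀ (x y : V) (q : (Gt ((t : ℕ) + 1)).Walk x y),
            IsAugPath (Gt ((t : ℕ) + 1)) (M t) q → e t ∈ q.edges →
              p.length ≤ q.length) ∧
          M ((t : ℕ) + 1) = M t ∆ p.edges.toFinset) ∨
      ((¬ ∃ (a b : V) (p : (Gt ((t : ℕ) + 1)).Walk a b),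
          IsAugPath (Gt ((t : ℕ) + 1)) (M t) p ∧ e t ∈ p.edges ∧
          p.length ≤ k - 1) ∧
        M ((t : ℕ) + 1) = M t)) :
    (∀ t ≤ m, ∀ (a b : V) (p : (Gt t).Walk a b), IsAugPath (Gt t) (M t) p →
      k + 1 ≤ p.length) ∧
    (∀ N : Finset (Sym2 V), IsMatching G N →
      (1 - 2 / ((k : ℝ) + 2)) * (N.card : ℝ) ≤ ((M m).card : ℝ)) := by
  have hshort : ∀ t ≤ m, ∀ (a b : V) (p : (Gt t).Walk a b), IsAugPath (Gt t) (M t) p →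
      k + 1 ≤ p.length := by
    intro t
    induction t with
    | zero =>
      intro _ a b p hp
      cases p with
      | nil => simpa using hp.pos
      | cons h q =>
        obtain ⟨i, hi, -⟩ := (hGt 0 _ _).1 h
        omega
    | succ t ih =>
      intro ht
      have ih' := ih (by omega)
      have old : ∀ (a b : V) (p : (Gt (t + 1)).Walk a b), IsAugPath (Gt (t + 1)) (M t) p →
          e ⟨t, ht⟩ ∉ p.edges → k + 1 ≤ p.length := by
        intro a b p hp hnot
        have hedges : ∀ f ∈ p.edges, f ∈ (Gt t).edgeSet := by
          intro f hf
          have hf' := p.edges_subset_edgeSet hf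
          induction f using Sym2.ind with
          | _ x y =>
          obtain ⟨i, hi, hie⟩ := (hGt _ _ _).1 hf'
          refine (hGt _ _ _).2 ⟨i, ?_, hie⟩
          rcases Nat.lt_succ_iff_lt_or_eq.1 hi with h | h
          · exact h
          · obtain rfl : i = ⟨t, ht⟩ := Fin.ext h
            exact absurd (hie ▸ hf) hnot
        simpa using ih' a b _ (hp.transfer hedges)
      have hMt : IsMatching (Gt (t + 1)) (M t) := by
        refine ⟨fun f hf => ?_, (hmatch t (by omega)).2⟩
        have hf' := (hmatch t (by omega)).1 hf
        induction f using Sym2.ind with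
        | _ x y =>
        obtain ⟨i, hi, hie⟩ := (hGt _ _ _).1 hf'
        exact (hGt _ _ _).2 ⟨i, by omega, hie⟩
      rcases hstep ⟨t, ht⟩ with ⟨a, b, p, hp, -, hlen, hmin, hMnew⟩ | ⟨hno, hMnew⟩
      · intro c d q hq
        simp only at hp hlen hmin hMnew
        have hq' : IsAugPath (Gt (t + 1)) (M t ∆ p.edges.toFinset) q := by
          convert hq using 1
          rw [hMnew]
        obtain ⟨a₁, b₁, a₂, b₂, p₁, p₂, h₁, h₂, hdisj, hsum⟩ := hp.exists_two hMt hq'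
        by_cases hin : e ⟨t, ht⟩ ∈ p₁.edges
        · have := hmin _ _ p₁ h₁ hin
          have := old _ _ p₂ h₂ (hdisj hin)
          omega
        · have := old _ _ p₁ h₁ hin
          by_cases hin₂ : e ⟨t, ht⟩ ∈ p₂.edges
          · have := hmin _ _ p₂ h₂ hin₂
            omega
          · have := old _ _ p₂ h₂ hin₂
            omega
      · intro a b p hp
        simp only at hno hMnew
        rw [hMnew] at hp
        by_cases hin : e ⟨t, ht⟩ ∈ p.edges
        · have hlt : ¬ p.length ≤ k - 1 := fun h => hno ⟨a, b, p, hp, hin, h⟩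
          obtain ⟨r, hr⟩ := (hp.augment hMt).2.2
          obtain ⟨s, hs⟩ := hk2
          omega
        · exact old a b p hp hin
  refine ⟨hshort, fun N hN => ?_⟩
  have hN' : IsMatching (Gt m) N := by
    refine ⟨fun f hf => ?_, hN.2⟩
    obtain ⟨i, rfl⟩ := hsurj f (hN.1 hf)
    induction hi : e i using Sym2.ind with
    | _ x y => exact (hGt _ _ _).2 ⟨i, i.2, hi⟩
  have hM := hmatch m le_rfl
  have hnat : N.card * k ≤ (M m).card * (k + 2) := by
    rcases le_total N.card (M m).card with h | h
    · exact Nat.mul_le_mul h (by omega)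
    · obtain ⟨d, hd⟩ := Nat.exists_eq_add_of_le h
      have h1 := hM.mul_le_card_symmDiff hN' (hshort m le_rfl) hd.ge
      have h2 : (M m ∆ N).card ≤ (M m).card + N.card :=
        (Finset.card_le_card symmDiff_le_sup).trans (Finset.card_union_le _ _)
      rw [hd] at h2 ⊢
      nlinarith
  have hreal : (N.card : ℝ) * k ≤ (M m).card * (k + 2) := by exact_mod_cast hnat
  have hk : (0 : ℝ) < k + 2 := by positivity
  rw [one_sub_div hk.ne', div_mul_eq_mul_div, div_le_iff₀ hk]
  linarith
end
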